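/- arXiv:math/0409202 — 2 statements merged into one kernel-verified Lean document; each statement's English description precedes it below -/
import Mathlib

section
/- Let Q be a rack, A a commutative ring, m ⊆ A an ideal, n ≥ 1, and let f: AQ^n → AQ^n be an A-linear map all of whose matrix entries lie in m. For any k ∈ {0,…,n}, one has d_k f = d_{k+1} f = ⋯ = d_n f = 0 if and only if both of the following hold: (D_k) f^{x_1,…,x_n}_{y_1,…,y_n} = 0 whenever x_i ≢ y_i for some index i > k; and (E_k) f^{x_1,…,x_n}_{y_1,…,y_n} = f^{x_1^α,…,x_i^α,x_{i+1},…,x_n}_{y_1^α,…,y_i^α,y_{i+1},…,y_n} for all α ∈ Inn(Q) and all i ≥ k. -/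
open TensorProduct

noncomputable section

/-- A rack: a set with a binary operation `act x y = x ^ y` such that all right
translations are bijective and the operation is right self-distributive. -/
structure YBRack (Q : Type*) where
  act : Q → Q → Q
  act_bijective : ∀ y : Q, Function.Bijective fun x => act x y
  self_distrib : ∀ x y z : Q, act (act x y) z = act (act x z) (act y z)

namespace YBRack

variable {Q : Type*} {A : Type*} [CommRing A]

/-- Right translation by `y` as a permutation of `Q`. -/
def rho (R : YBRack Q) (y : Q) : Equiv.Perm Q :=
  Equiv.ofBijective _ (R.act_bijective y)

/-- The inner automorphism group of a rack: the subgroup of `Perm Q` generated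
by all right translations. -/
def Inn (R : YBRack Q) : Subgroup (Equiv.Perm Q) :=
  Subgroup.closure (Set.range R.rho)

/-- Behavioural equivalence: `x ≡ y` iff `ϱ(x) = ϱ(y)`. -/
def BEquiv (R : YBRack Q) (x y : Q) : Prop := R.rho x = R.rho y

end YBRack
namespace YBRack

variable {Q : Type*} {A : Type*} [CommRing A]

/-- Iterated rack action by the elements of a list: `x ^ (z₁ z₂ ⋯ z_k)`. -/
def actList (R : YBRack Q) (x : Q) (l : List Q) : Q := l.foldl R.act x

open scoped Classical in
/-- The `i`-th partial coboundary operator `d_i` on matrices of `n`-cochains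
(indices `0, …, n` correspond to the paper's `x_0, …, x_n`). -/
def dPart (R : YBRack Q) {n : ℕ} (f : (Fin n → Q) → (Fin n → Q) → A) (i : Fin (n+1))
    (x y : Fin (n+1) → Q) : A :=
  f (fun j => x (i.succAbove j)) (fun j => y (i.succAbove j)) *
      (if R.actList (x i) ((List.ofFn x).drop ((i : ℕ)+1))
          = R.actList (y i) ((List.ofFn y).drop ((i : ℕ)+1)) then 1 else 0)
  - f (fun j => if (j : ℕ) < (i : ℕ) then R.act (x (i.succAbove j)) (x i) else x (i.succAbove j))
      (fun j => if (j : ℕ) < (i : ℕ) then R.act (y (i.succAbove j)) (y i) else y (i.succAbove j)) *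
      (if x i = y i then 1 else 0)

/-- The full coboundary operator `d = Σ_{i=0}^{n} (-1)^i d_i`. -/
def dSum (R : YBRack Q) {n : ℕ} (f : (Fin n → Q) → (Fin n → Q) → A)
    (x y : Fin (n+1) → Q) : A :=
  ∑ i : Fin (n+1), (-1 : A) ^ (i : ℕ) * R.dPart f i x y

/-- A matrix is quasi-diagonal if its entry vanishes as soon as some pair of
indices is not behaviourally equivalent. -/
def QuasiDiagonal (R : YBRack Q) {n : ℕ} (f : (Fin n → Q) → (Fin n → Q) → A) : Prop :=
  ∀ x y : Fin n → Q, (∃ i : Fin n, ¬ R.BEquiv (x i) (y i)) → f x y = 0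

/-- A matrix is fully equivariant if it is invariant under the coordinatewise
action of `Inn(Q)^n`. -/
def FullyEquivariant (R : YBRack Q) {n : ℕ} (f : (Fin n → Q) → (Fin n → Q) → A) : Prop :=
  ∀ (x y : Fin n → Q) (α : Fin n → R.Inn),
    f (fun i => (α i : Equiv.Perm Q) (x i)) (fun i => (α i : Equiv.Perm Q) (y i)) = f x y

end YBRack

namespace YBRack

variable {Q : Type*} {A : Type*} [CommRing A]

/-- Apply the permutation `σ` to the coordinates of `x` with index less than `i`. -/
def permBelow {n : ℕ} (i : ℕ) (σ : Equiv.Perm Q) (x : Fin n → Q) : Fin n → Q :=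
  fun j => if (j : ℕ) < i then σ (x j) else x j

theorem permBelow_one {n : ℕ} (i : ℕ) (x : Fin n → Q) : permBelow i 1 x = x := by
  funext j
  exact ite_self _

theorem permBelow_mul {n : ℕ} (i : ℕ) (σ τ : Equiv.Perm Q) (x : Fin n → Q) :
    permBelow i (σ * τ) x = permBelow i σ (permBelow i τ x) := by
  funext j
  by_cases h : (j : ℕ) < i <;> simp [permBelow, h]

theorem permBelow_of_le {n : ℕ} {i : ℕ} (σ : Equiv.Perm Q) (x : Fin n → Q) {j : Fin n}
    (h : i ≤ j) : permBelow i σ x j = x j :=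
  if_neg (not_lt.mpr h)

theorem actList_injective (R : YBRack Q) (l : List Q) :
    Function.Injective fun a => R.actList a l := by
  induction l with
  | nil => exact Function.injective_id
  | cons z l ih => exact ih.comp (R.act_bijective z).injective

theorem actList_congr (R : YBRack Q) {l l' : List Q} (h : l.map R.rho = l'.map R.rho) (a : Q) :
    R.actList a l = R.actList a l' := by
  induction l generalizing l' a with
  | nil =>
    obtain rfl : l' = [] := by simpa using h.symm
    rfl
  | cons z l ih =>
    cases l' with
    | nil => simp at h
    | cons z' l' =>
      simp only [List.map_cons, List.cons.injEq] at h
      have hz : R.act a z = R.act a z' := congrArg (fun σ : Equiv.Perm Q => σ a) h.1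
      change R.actList (R.act a z) l = R.actList (R.act a z') l'
      rw [hz, ih h.2]

theorem actList_drop_ofFn_congr (R : YBRack Q) {n i : ℕ} {x y : Fin n → Q}
    (h : ∀ j : Fin n, i ≤ j → R.BEquiv (x j) (y j)) (a : Q) :
    R.actList a ((List.ofFn x).drop i) = R.actList a ((List.ofFn y).drop i) := by
  refine R.actList_congr (List.ext_getElem (by simp) fun j hj _ => ?_) a
  simpa [BEquiv] using h ⟨i + j, by simp at hj; omega⟩ (Nat.le_add_right i j)

theorem drop_ofFn_insertNth {n : ℕ} (i : Fin (n + 1)) (a : Q) (x : Fin n → Q) :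
    (List.ofFn (i.insertNth a x : Fin (n + 1) → Q)).drop (i + 1) = (List.ofFn x).drop i := by
  refine List.ext_getElem (by simp) fun j hj hj' => ?_
  simp only [List.length_drop, List.length_ofFn] at hj'
  have hs : (⟨i + 1 + j, by omega⟩ : Fin (n + 1)) = i.succAbove ⟨i + j, by omega⟩ := by
    rw [Fin.succAbove_of_le_castSucc _ _ (by simp [Fin.le_def])]
    ext
    simp
    omega
  simp only [List.getElem_drop, List.getElem_ofFn]
  rw [hs, Fin.insertNth_apply_succAbove]

open scoped Classical in
theorem dPart_insertNth (R : YBRack Q) {n : ℕ} (f : (Fin n → Q) → (Fin n → Q) → A)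
    (i : Fin (n + 1)) (a b : Q) (x y : Fin n → Q) :
    R.dPart f i (i.insertNth a x) (i.insertNth b y) =
      f x y * (if R.actList a ((List.ofFn x).drop i) = R.actList b ((List.ofFn y).drop i)
        then 1 else 0) -
      f (permBelow i (R.rho a) x) (permBelow i (R.rho b) y) * (if a = b then 1 else 0) := by
  simp only [dPart, drop_ofFn_insertNth, Fin.insertNth_apply_succAbove, Fin.insertNth_apply_same]
  rfl

theorem apply_permBelow_of_mem_inn {B : Type*} (R : YBRack Q) {n : ℕ}
    (f : (Fin n → Q) → (Fin n → Q) → B)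
    (i : ℕ) (h : ∀ a x y, f x y = f (permBelow i (R.rho a) x) (permBelow i (R.rho a) y))
    {σ : Equiv.Perm Q} (hσ : σ ∈ R.Inn) (x y : Fin n → Q) :
    f x y = f (permBelow i σ x) (permBelow i σ y) := by
  induction hσ using Subgroup.closure_induction generalizing x y with
  | mem σ hσ =>
    obtain ⟨a, rfl⟩ := hσ
    exact h a x y
  | one => simp only [permBelow_one]
  | mul σ τ _ _ hσ hτ => rw [permBelow_mul, permBelow_mul, ← hσ, ← hτ]
  | inv σ _ hσ =>
    rw [hσ (permBelow i σ⁻¹ x), ← permBelow_mul, ← permBelow_mul, mul_inv_cancel,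
      permBelow_one, permBelow_one]

theorem dPart_eq_zero (R : YBRack Q) {n : ℕ} (f : (Fin n → Q) → (Fin n → Q) → A)
    (i : Fin (n + 1))
    (hD : ∀ x y : Fin n → Q, (∃ j : Fin n, (i : ℕ) ≤ j ∧ ¬ R.BEquiv (x j) (y j)) → f x y = 0)
    (hE : ∀ a x y, f x y = f (permBelow i (R.rho a) x) (permBelow i (R.rho a) y))
    (x y : Fin (n + 1) → Q) : R.dPart f i x y = 0 := by
  rw [← Fin.insertNth_self_removeNth i x, ← Fin.insertNth_self_removeNth i y, dPart_insertNth]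
  generalize x i = a, i.removeNth x = x, y i = b, i.removeNth y = y
  by_cases h : ∃ j : Fin n, (i : ℕ) ≤ j ∧ ¬ R.BEquiv (x j) (y j)
  · by_cases hab : a = b
    · subst hab
      simp [← hE, hD x y h]
    · simp [hab, hD x y h]
  · push Not at h
    rw [R.actList_drop_ofFn_congr h]
    by_cases hab : a = b
    · subst hab
      simp [← hE]
    · simp [hab, (R.actList_injective _).eq_iff]

theorem apply_eq_zero_of_dPart_eq_zero (R : YBRack Q) {n : ℕ}
    (f : (Fin n → Q) → (Fin n → Q) → A) {j : Fin n} (hd : ∀ x y, R.dPart f j.castSucc x y = 0)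
    {x y : Fin n → Q} (hj : ¬ R.BEquiv (x j) (y j))
    (hlt : ∀ l, j < l → R.BEquiv (x l) (y l)) : f x y = 0 := by
  obtain ⟨a, ha⟩ : ∃ a, R.rho (x j) a ≠ R.rho (y j) a := by
    by_contra! h
    exact hj (Equiv.ext h)
  obtain ⟨b, hb⟩ := (R.rho (y j)).surjective (R.rho (x j) a)
  have hab : a ≠ b := by
    rintro rfl
    exact ha hb.symm
  have hdrop : ∀ z : Fin n → Q, (List.ofFn z).drop j = z j :: (List.ofFn z).drop (j + 1) := by
    intro z
    rw [List.drop_eq_getElem_cons (by simp)]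
    simp
  have hact : R.actList a ((List.ofFn x).drop j) = R.actList b ((List.ofFn y).drop j) := by
    rw [hdrop x, hdrop y]
    change R.actList (R.rho (x j) a) _ = R.actList (R.rho (y j) b) _
    rw [hb, R.actList_drop_ofFn_congr fun l hl => hlt l hl]
  have h := hd (j.castSucc.insertNth a x) (j.castSucc.insertNth b y)
  rw [dPart_insertNth] at h
  simpa [hab, hact] using h

theorem apply_permBelow_rho_of_dPart_eq_zero (R : YBRack Q) {n : ℕ}
    (f : (Fin n → Q) → (Fin n → Q) → A) (i : Fin (n + 1)) (hd : ∀ x y, R.dPart f i x y = 0)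
    (hD : ∀ x y : Fin n → Q, (∃ j : Fin n, (i : ℕ) ≤ j ∧ ¬ R.BEquiv (x j) (y j)) → f x y = 0)
    (a : Q) (x y : Fin n → Q) :
    f x y = f (permBelow i (R.rho a) x) (permBelow i (R.rho a) y) := by
  by_cases h : ∃ j : Fin n, (i : ℕ) ≤ j ∧ ¬ R.BEquiv (x j) (y j)
  · obtain ⟨j, hij, hj⟩ := h
    rw [hD x y ⟨j, hij, hj⟩, hD]
    exact ⟨j, hij, by rwa [permBelow_of_le _ _ hij, permBelow_of_le _ _ hij]⟩
  · push Not at h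
    have h0 := hd (i.insertNth a x) (i.insertNth a y)
    rw [dPart_insertNth, R.actList_drop_ofFn_congr h] at h0
    simpa [sub_eq_zero] using h0

end YBRack

/-- (Lemma on partial entropy conditions.) For a matrix `f` of an
`A`-linear map `AQ^n → AQ^n` with entries in an ideal `m`, and `0 ≤ k ≤ n`, one has
`d_k f = ⋯ = d_n f = 0` iff the conditions `(D_k)` and `(E_k)` hold.  Here the `n`
indices of `f` are numbered `0, …, n-1`, corresponding to the paper's `1, …, n`. -/
theorem dPart_vanish_from_iff
    {A Q : Type*} [CommRing A] (R : YBRack Q) (m : Ideal A) {n : ℕ} (hn : 1 ≤ n)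
    (f : (Fin n → Q) → (Fin n → Q) → A) (hf : ∀ x y, f x y ∈ m)
    (k : ℕ) (hk : k ≤ n) :
    (∀ i : Fin (n+1), k ≤ (i : ℕ) → ∀ x y, R.dPart f i x y = 0) ↔
      ((∀ x y : Fin n → Q, (∃ i : Fin n, k ≤ (i : ℕ) ∧ ¬ R.BEquiv (x i) (y i)) → f x y = 0) ∧
        (∀ i : ℕ, k ≤ i → i ≤ n → ∀ α : R.Inn, ∀ x y : Fin n → Q,
          f x y = f (fun j => if (j : ℕ) < i then (α : Equiv.Perm Q) (x j) else x j)
            (fun j => if (j : ℕ) < i then (α : Equiv.Perm Q) (y j) else y j))) := by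
  constructor
  · intro hd
    have hD : ∀ x y : Fin n → Q,
        (∃ i : Fin n, k ≤ (i : ℕ) ∧ ¬ R.BEquiv (x i) (y i)) → f x y = 0 := by
      intro x y h
      obtain ⟨j, ⟨hkj, hj⟩, hmax⟩ :=
        (Set.toFinite {i : Fin n | k ≤ (i : ℕ) ∧ ¬ R.BEquiv (x i) (y i)}).exists_maximal h
      refine R.apply_eq_zero_of_dPart_eq_zero f (hd j.castSucc hkj) hj fun l hl => ?_
      by_contra hxl
      exact not_lt_of_ge (hmax ⟨hkj.trans hl.le, hxl⟩ hl.le) hl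
    refine ⟨hD, fun i hki hin α x y => ?_⟩
    exact R.apply_permBelow_of_mem_inn f i
      (R.apply_permBelow_rho_of_dPart_eq_zero f ⟨i, Nat.lt_succ_of_le hin⟩ (hd _ hki)
        fun x y ⟨j, hij, hj⟩ => hD x y ⟨j, hki.trans hij, hj⟩) α.2 x y
  · rintro ⟨hD, hE⟩ i hki
    exact R.dPart_eq_zero f i (fun x y ⟨j, hij, hj⟩ => hD x y ⟨j, hki.trans hij, hj⟩)
      fun a => hE i hki i.is_le ⟨R.rho a, Subgroup.subset_closure ⟨a, rfl⟩⟩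

end
end

section
/- Let Q be a rack, A a commutative ring, and m ⊆ A an ideal with m² = 0. Suppose Inn(Q) is finite and its order |Inn(Q)|, regarded as an element of A, is a unit. Then every Yang-Baxter deformation c of c_Q with respect to m is equivalent to exactly one entropic deformation: there exists a unique entropic automorphism f of AQ² whose matrix is congruent to the identity modulo m such that c is equivalent to c_Q ∘ f. -/
open TensorProduct

noncomputable section

/-- Matrix of a linear endomorphism of `AQ ⊗ AQ`, via the identification of
`AQ ⊗ AQ` with the free module on `Q × Q`. -/
def mat2 (A : Type*) [CommRing A] {Q : Type*}
    (f : ((Q →₀ A) ⊗[A] (Q →₀ A)) →ₗ[A] ((Q →₀ A) ⊗[A] (Q →₀ A))) (p q : Q × Q) : A :=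
  finsuppTensorFinsupp' A Q Q (f ((finsuppTensorFinsupp' A Q Q).symm (Finsupp.single p 1))) q

/-- Matrix of a linear endomorphism of `AQ`. -/
def mat1 (A : Type*) [CommRing A] {Q : Type*}
    (f : (Q →₀ A) →ₗ[A] (Q →₀ A)) (x u : Q) : A :=
  f (Finsupp.single x 1) u

/-- The Yang–Baxter (braid) equation for an endomorphism of `M ⊗ M`, where
`c₁ = c ⊗ id` and `c₂ = id ⊗ c` act on `(M ⊗ M) ⊗ M`. -/
def YBE {A M : Type*} [CommRing A] [AddCommGroup M] [Module A M]
    (c : (M ⊗[A] M) →ₗ[A] (M ⊗[A] M)) : Prop :=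
  (LinearMap.rTensor M c) ∘ₗ
      ((TensorProduct.assoc A M M M).symm.toLinearMap ∘ₗ (LinearMap.lTensor M c) ∘ₗ
        (TensorProduct.assoc A M M M).toLinearMap) ∘ₗ (LinearMap.rTensor M c)
    = ((TensorProduct.assoc A M M M).symm.toLinearMap ∘ₗ (LinearMap.lTensor M c) ∘ₗ
        (TensorProduct.assoc A M M M).toLinearMap) ∘ₗ (LinearMap.rTensor M c) ∘ₗ
      ((TensorProduct.assoc A M M M).symm.toLinearMap ∘ₗ (LinearMap.lTensor M c) ∘ₗ
        (TensorProduct.assoc A M M M).toLinearMap)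

/-- A Yang–Baxter operator: a bijective linear endomorphism of `M ⊗ M`
satisfying the Yang–Baxter equation. -/
def IsYBOp {A M : Type*} [CommRing A] [AddCommGroup M] [Module A M]
    (c : (M ⊗[A] M) →ₗ[A] (M ⊗[A] M)) : Prop :=
  Function.Bijective c ∧ YBE c

/-- An endomorphism of `AQ ⊗ AQ` is entropic (with respect to the rack `R`)
if its matrix is quasi-diagonal and fully equivariant. -/
def Entropic2 {Q : Type*} (R : YBRack Q) (A : Type*) [CommRing A]
    (f : ((Q →₀ A) ⊗[A] (Q →₀ A)) →ₗ[A] ((Q →₀ A) ⊗[A] (Q →₀ A))) : Prop :=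
  (∀ x y u v : Q, (¬ R.BEquiv x u ∨ ¬ R.BEquiv y v) → mat2 A f (x, y) (u, v) = 0) ∧
  (∀ (x y u v : Q) (α β : R.Inn),
    mat2 A f ((α : Equiv.Perm Q) x, (β : Equiv.Perm Q) y)
        ((α : Equiv.Perm Q) u, (β : Equiv.Perm Q) v)
      = mat2 A f (x, y) (u, v))

open scoped Classical in
/-- Two Yang–Baxter operators are equivalent with respect to the ideal `m` if
they are conjugate by `α ⊗ α` for some automorphism `α` of `AQ` congruent to
the identity modulo `m`. -/
def YBEquivalent {Q A : Type*} [CommRing A] (m : Ideal A)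
    (c c' : ((Q →₀ A) ⊗[A] (Q →₀ A)) →ₗ[A] ((Q →₀ A) ⊗[A] (Q →₀ A))) : Prop :=
  ∃ α : (Q →₀ A) ≃ₗ[A] (Q →₀ A),
    (∀ x u : Q, (α (Finsupp.single x 1)) u - (if x = u then 1 else 0) ∈ m) ∧
    c' = (TensorProduct.congr α α).toLinearMap ∘ₗ c ∘ₗ (TensorProduct.congr α α).symm.toLinearMap

namespace YBRack

section Cochains

variable {A Q : Type*} [CommRing A]

open scoped Classical in
/-- Kronecker symbol with values in `A`. -/
def delta (A : Type*) [CommRing A] {Q : Type*} (x u : Q) : A := if x = u then 1 else 0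

theorem delta_self (x : Q) : delta A x x = 1 := if_pos rfl

theorem delta_of_ne {x u : Q} (h : x ≠ u) : delta A x u = 0 := if_neg h

theorem delta_congr {x u : Q} {P : Type*} {y v : P} (h : x = u ↔ y = v) :
    delta A x u = delta A y v := by
  by_cases e : x = u
  · rw [delta, delta, if_pos e, if_pos (h.mp e)]
  · rw [delta, delta, if_neg e, if_neg (mt h.mpr e)]

theorem act_right_inj (R : YBRack Q) (x u y : Q) : R.act x y = R.act u y ↔ x = u :=
  (R.act_bijective y).1.eq_iff

theorem bEquiv_iff (R : YBRack Q) (x u : Q) : R.BEquiv x u ↔ ∀ y, R.act y x = R.act y u := by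
  simp only [BEquiv, Equiv.ext_iff]
  rfl

theorem rho_mem_Inn (R : YBRack Q) (y : Q) : R.rho y ∈ R.Inn :=
  Subgroup.subset_closure ⟨y, rfl⟩

theorem Inn_map_act (R : YBRack Q) {g : Equiv.Perm Q} (hg : g ∈ R.Inn) (x y : Q) :
    g (R.act x y) = R.act (g x) (g y) := by
  induction hg using Subgroup.closure_induction generalizing x y with
  | mem g hg =>
    obtain ⟨z, rfl⟩ := hg
    exact R.self_distrib x y z
  | one => rfl
  | mul g h _ _ ihg ihh => simp [ihg, ihh]
  | inv g _ ih =>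
    apply g.injective
    simp [ih]

theorem bEquiv_map_iff (R : YBRack Q) {g : Equiv.Perm Q} (hg : g ∈ R.Inn) (x u : Q) :
    R.BEquiv (g x) (g u) ↔ R.BEquiv x u := by
  simp only [bEquiv_iff]
  rw [← g.forall_congr_right]
  simp only [← R.Inn_map_act hg, g.injective.eq_iff]

/-- Row-finite matrices with entries in `m`. -/
def rowFinite (Q : Type*) {A : Type*} [CommRing A] (m : Ideal A) : Submodule A (Q → Q → A) where
  carrier := {a | (∀ x u, a x u ∈ m) ∧ ∀ x, (Function.support (a x)).Finite}
  zero_mem' := ⟨fun _ _ => m.zero_mem, fun _ => by simp⟩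
  add_mem' {a b} ha hb := ⟨fun x u => m.add_mem (ha.1 x u) (hb.1 x u), fun x =>
    ((ha.2 x).union (hb.2 x)).subset (Function.support_add (a x) (b x))⟩
  smul_mem' r a ha := ⟨fun x u => m.mul_mem_left r (ha.1 x u), fun x =>
    (ha.2 x).subset (Function.support_const_smul_subset r (a x))⟩

/-- The differential from matrices of degree one to matrices of degree two in the
Yang–Baxter complex of the rack. -/
def coboundary (R : YBRack Q) (A : Type*) [CommRing A] :
    (Q → Q → A) →ₗ[A] (Q → Q → Q → Q → A) where
  toFun a x y u v := delta A y v * (a (R.act x y) (R.act u v) - a x u)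
    + (delta A (R.act x y) (R.act u v) - delta A x u) * a y v
  map_add' a b := by
    funext x y u v
    simp only [Pi.add_apply]
    ring
  map_smul' r a := by
    funext x y u v
    simp only [Pi.smul_apply, smul_eq_mul, RingHom.id_apply]
    ring

/-- Infinitesimal Yang–Baxter deformations of the rack, as matrices of degree two. -/
def cocycles (R : YBRack Q) (A : Type*) [CommRing A] : Submodule A (Q → Q → Q → Q → A) where
  carrier := {F | ∀ x y z u v w,
    delta A z w * F x y u v + delta A y v * F (R.act x y) z (R.act u v) w
      + delta A (R.act (R.act x y) z) (R.act (R.act u v) w) * F y z v w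
    = delta A x u * F y z v w + delta A (R.act y z) (R.act v w) * F x z u w
      + delta A z w * F (R.act x z) (R.act y z) (R.act u w) (R.act v w)}
  zero_mem' x y z u v w := by simp
  add_mem' {F G} hF hG x y z u v w := by
    simp only [Pi.add_apply]
    linear_combination hF x y z u v w + hG x y z u v w
  smul_mem' r F hF x y z u v w := by
    simp only [Pi.smul_apply, smul_eq_mul]
    linear_combination r * hF x y z u v w

/-- Diagonal translation of a matrix of degree two. -/
def translate (A : Type*) [CommRing A] {Q : Type*} (g : Equiv.Perm Q) :
    (Q → Q → Q → Q → A) →ₗ[A] (Q → Q → Q → Q → A) where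
  toFun F x y u v := F (g x) (g y) (g u) (g v)
  map_add' _ _ := rfl
  map_smul' _ _ := rfl

theorem translate_apply (g : Equiv.Perm Q) (F : Q → Q → Q → Q → A) (x y u v : Q) :
    translate A g F x y u v = F (g x) (g y) (g u) (g v) := rfl

theorem coboundary_apply (R : YBRack Q) (a : Q → Q → A) (x y u v : Q) :
    R.coboundary A a x y u v = delta A y v * (a (R.act x y) (R.act u v) - a x u)
      + (delta A (R.act x y) (R.act u v) - delta A x u) * a y v := rfl

theorem translate_coboundary_mem (R : YBRack Q) {m : Ideal A} {g : Equiv.Perm Q}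
    (hg : g ∈ R.Inn) {F : Q → Q → Q → Q → A}
    (hF : F ∈ (rowFinite Q m).map (R.coboundary A)) :
    translate A g F ∈ (rowFinite Q m).map (R.coboundary A) := by
  obtain ⟨a, ha, rfl⟩ := hF
  refine ⟨fun x u => a (g x) (g u), ⟨fun x u => ha.1 _ _, fun x =>
    (ha.2 (g x)).preimage g.injective.injOn⟩, ?_⟩
  funext x y u v
  simp only [translate_apply, coboundary_apply, ← R.Inn_map_act hg]
  simp only [delta_congr (A := A) g.injective.eq_iff]

theorem translate_mem_cocycles (R : YBRack Q) {g : Equiv.Perm Q}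
    (hg : g ∈ R.Inn) {F : Q → Q → Q → Q → A} (hF : F ∈ R.cocycles A) :
    translate A g F ∈ R.cocycles A := by
  intro x y z u v w
  have := hF (g x) (g y) (g z) (g u) (g v) (g w)
  simp only [← R.Inn_map_act hg, delta_congr (A := A) g.injective.eq_iff] at this
  exact this

/-- Inner translations act trivially on cocycles up to coboundaries. -/
theorem translate_sub_mem_coboundary (R : YBRack Q) {m : Ideal A} {F : Q → Q → Q → Q → A}
    (hF : F ∈ R.cocycles A) (hFm : ∀ x y u v, F x y u v ∈ m)
    (hfin : ∀ x y, (Function.support fun p : Q × Q => F x y p.1 p.2).Finite)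
    {g : Equiv.Perm Q} (hg : g ∈ R.Inn) :
    translate A g F - F ∈ (rowFinite Q m).map (R.coboundary A) := by
  induction hg using Subgroup.closure_induction with
  | mem g hg =>
    obtain ⟨z, rfl⟩ := hg
    refine ⟨fun x u => F x z u z, ⟨fun x u => hFm _ _ _ _, fun x =>
      (hfin x z).preimage (Prod.mk_left_injective z).injOn⟩, ?_⟩
    funext x y u v
    have h := hF x y z u v z
    rw [delta_self, delta_congr (A := A) (R.act_right_inj _ _ z),
      delta_congr (A := A) (R.act_right_inj y v z)] at h
    have e : translate A (R.rho z) F x y u v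
      = F (R.act x z) (R.act y z) (R.act u z) (R.act v z) := rfl
    rw [coboundary_apply, Pi.sub_apply, Pi.sub_apply, Pi.sub_apply, Pi.sub_apply, e]
    linear_combination h
  | one =>
    have : translate A (1 : Equiv.Perm Q) F = F := rfl
    rw [this, sub_self]
    exact Submodule.zero_mem _
  | mul g h _ hh ihg ihh =>
    have e : translate A (g * h) F - F
        = translate A h (translate A g F - F) + (translate A h F - F) := by
      rw [LinearMap.map_sub, sub_add_sub_cancel]
      rfl
    rw [e]
    exact add_mem (R.translate_coboundary_mem hh ihg) ihh
  | inv g hg ih =>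
    have e : translate A g⁻¹ F - F = -translate A g⁻¹ (translate A g F - F) := by
      rw [LinearMap.map_sub, neg_sub]
      congr 1
      funext x y u v
      simp [translate_apply]
    rw [e]
    exact neg_mem (R.translate_coboundary_mem (inv_mem hg) ih)

/-- If `|Inn(Q)|` is invertible, every cocycle is cohomologous to an equivariant one. -/
theorem exists_equivariant (R : YBRack Q) {m : Ideal A} [Fintype R.Inn]
    (hunit : IsUnit ((Fintype.card R.Inn : A))) {F : Q → Q → Q → Q → A}
    (hF : F ∈ R.cocycles A) (hFm : ∀ x y u v, F x y u v ∈ m)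
    (hfin : ∀ x y, (Function.support fun p : Q × Q => F x y p.1 p.2).Finite) :
    ∃ a ∈ rowFinite Q m, F + R.coboundary A a ∈ R.cocycles A ∧
      ∀ g ∈ R.Inn, translate A g (F + R.coboundary A a) = F + R.coboundary A a := by
  obtain ⟨N, hN⟩ := hunit
  have hmem : ((N⁻¹ : Aˣ) : A) • ∑ g : R.Inn, (translate A (g : Equiv.Perm Q) F - F)
      ∈ (rowFinite Q m).map (R.coboundary A) :=
    Submodule.smul_mem _ _ (sum_mem fun g _ => R.translate_sub_mem_coboundary hF hFm hfin g.2)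
  obtain ⟨a, ha, e⟩ := hmem
  have key : F + R.coboundary A a
      = ((N⁻¹ : Aˣ) : A) • ∑ g : R.Inn, translate A (g : Equiv.Perm Q) F := by
    rw [e, Finset.sum_sub_distrib, Finset.sum_const, Finset.card_univ, smul_sub,
      ← Nat.cast_smul_eq_nsmul A, ← hN, smul_smul, Units.inv_mul, one_smul, add_sub_cancel]
  refine ⟨a, ha, ?_, fun g hg => ?_⟩
  · rw [key]
    exact Submodule.smul_mem _ _ (sum_mem fun g _ => R.translate_mem_cocycles g.2 hF)
  · have hsum : translate A g (∑ h : R.Inn, translate A (h : Equiv.Perm Q) F)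
        = ∑ h : R.Inn, translate A g (translate A (h : Equiv.Perm Q) F) := by
      funext x y u v
      simp only [translate_apply, Finset.sum_apply]
    rw [key, map_smul, hsum]
    congr 1
    exact Fintype.sum_equiv (Equiv.mulRight (⟨g, hg⟩ : R.Inn)) _ _ fun h => rfl

/-- A matrix of degree two is entropic if it is quasi-diagonal and fully equivariant. -/
def IsEntropicMatrix (R : YBRack Q) (F : Q → Q → Q → Q → A) : Prop :=
  (∀ x y u v : Q, (¬ R.BEquiv x u ∨ ¬ R.BEquiv y v) → F x y u v = 0) ∧
  ∀ (x y u v : Q) (α β : R.Inn),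
    F ((α : Equiv.Perm Q) x) ((β : Equiv.Perm Q) y) ((α : Equiv.Perm Q) u)
      ((β : Equiv.Perm Q) v) = F x y u v

theorem IsEntropicMatrix.sub {R : YBRack Q} {F G : Q → Q → Q → Q → A}
    (hF : R.IsEntropicMatrix F) (hG : R.IsEntropicMatrix G) : R.IsEntropicMatrix (F - G) :=
  ⟨fun x y u v h => by simp [hF.1 x y u v h, hG.1 x y u v h],
    fun x y u v α β => by simp only [Pi.sub_apply, hF.2, hG.2]⟩

/-- An entropic coboundary vanishes. -/
theorem IsEntropicMatrix.eq_zero_of_coboundary {R : YBRack Q} [Fintype R.Inn]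
    (hunit : IsUnit ((Fintype.card R.Inn : A))) {a : Q → Q → A}
    (h : R.IsEntropicMatrix (R.coboundary A a)) : R.coboundary A a = 0 := by
  funext x y u v
  by_cases hq : R.BEquiv x u ∧ R.BEquiv y v
  swap
  · exact h.1 x y u v (not_and_or.mp hq)
  by_cases hyv : y = v
  swap
  · rw [coboundary_apply, delta_of_ne hyv, ← (R.bEquiv_iff y v).mp hq.2 u,
      delta_congr (A := A) (R.act_right_inj x u y)]
    simp
  subst hyv
  have step (p q : Q) : R.coboundary A a p y q y = a (R.rho y p) (R.rho y q) - a p q := by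
    rw [coboundary_apply, delta_self, delta_congr (A := A) (R.act_right_inj p q y), sub_self,
      zero_mul, add_zero, one_mul]
    rfl
  have hg := R.rho_mem_Inn y
  have const (k : ℕ) : R.coboundary A a (((R.rho y) ^ k) x) y (((R.rho y) ^ k) u) y
      = R.coboundary A a x y u y := h.2 x y u y ⟨_, pow_mem hg k⟩ 1
  have tele : ∑ k ∈ Finset.range (Fintype.card R.Inn),
      R.coboundary A a (((R.rho y) ^ k) x) y (((R.rho y) ^ k) u) y = 0 := by
    have e (k : ℕ) : R.coboundary A a (((R.rho y) ^ k) x) y (((R.rho y) ^ k) u) y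
        = a (((R.rho y) ^ (k + 1)) x) (((R.rho y) ^ (k + 1)) u)
          - a (((R.rho y) ^ k) x) (((R.rho y) ^ k) u) := by
      rw [step, pow_succ']
      rfl
    simp only [e]
    rw [Finset.sum_range_sub fun k => a (((R.rho y) ^ k) x) (((R.rho y) ^ k) u)]
    have hp : (R.rho y) ^ Fintype.card R.Inn = 1 :=
      congrArg Subtype.val (pow_card_eq_one (x := (⟨R.rho y, hg⟩ : R.Inn)))
    rw [hp, pow_zero, sub_self]
  simp only [const, Finset.sum_const, Finset.card_range, nsmul_eq_mul] at tele
  exact hunit.mul_right_eq_zero.mp tele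

theorem exists_act_ne (R : YBRack Q) {x u : Q} (h : ¬ R.BEquiv x u) :
    ∃ y, R.act y x ≠ R.act y u := by
  rw [bEquiv_iff] at h
  push Not at h
  exact h

/-- There is a choice of elements separating inequivalent `z` and `w` which depends on `w` only
through its right translation. -/
theorem exists_separating (R : YBRack Q) : ∃ sep : Q → Equiv.Perm Q → Q,
    ∀ z w, ¬ R.BEquiv z w → R.act (sep z (R.rho w)) z ≠ R.act (sep z (R.rho w)) w := by
  classical
  have (z : Q) (t : Equiv.Perm Q) : ∃ y, R.rho z ≠ t → R.rho z y ≠ t y := by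
    by_cases h : R.rho z = t
    · exact ⟨z, fun h' => absurd h h'⟩
    · obtain ⟨y, hy⟩ := not_forall.mp (mt Equiv.ext h)
      exact ⟨y, fun _ => hy⟩
  choose sep hsep using this
  exact ⟨sep, fun z w h => hsep z (R.rho w) h⟩

/-- An equivariant cocycle is cohomologous to an entropic one. -/
theorem exists_entropic_of_equivariant (R : YBRack Q) {m : Ideal A} [Finite R.Inn]
    {F : Q → Q → Q → Q → A} (hF : F ∈ R.cocycles A) (hFm : ∀ x y u v, F x y u v ∈ m)
    (hfin : ∀ x y, (Function.support fun p : Q × Q => F x y p.1 p.2).Finite)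
    (heq : ∀ g ∈ R.Inn, translate A g F = F) :
    ∃ a ∈ rowFinite Q m, R.IsEntropicMatrix (F + R.coboundary A a) := by
  classical
  have hB (x y z u v w : Q) : delta A y v * F (R.act x y) z (R.act u v) w
      + delta A (R.act (R.act x y) z) (R.act (R.act u v) w) * F y z v w
      = delta A x u * F y z v w + delta A (R.act y z) (R.act v w) * F x z u w := by
    have h := hF x y z u v w
    by_cases hzw : z = w
    · subst hzw
      have e : F (R.act x z) (R.act y z) (R.act u z) (R.act v z) = F x y u v :=
        congrFun (congrFun (congrFun (congrFun (heq _ (R.rho_mem_Inn z)) x) y) u) v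
      rw [e] at h
      linear_combination h
    · rw [delta_of_ne (A := A) hzw] at h
      linear_combination h
  obtain ⟨sep, hsep⟩ := R.exists_separating
  set b : Q → Q → A := fun z w =>
    if R.BEquiv z w then 0 else F (sep z (R.rho w)) z (sep z (R.rho w)) w with hb
  have hbmem : b ∈ rowFinite Q m := by
    refine ⟨fun z w => ?_, fun z => ?_⟩
    · simp only [hb]
      split_ifs
      exacts [m.zero_mem, hFm _ _ _ _]
    · have hsub : Function.support (b z) ⊆ ⋃ t : R.Inn,
          (fun w => (sep z t, w)) ⁻¹' Function.support fun p : Q × Q => F (sep z t) z p.1 p.2 := by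
        intro w hw
        simp only [hb, Function.mem_support, ne_eq, ite_eq_left_iff, not_forall] at hw
        obtain ⟨-, hw⟩ := hw
        exact Set.mem_iUnion.mpr ⟨⟨R.rho w, R.rho_mem_Inn w⟩, hw⟩
      refine (Set.finite_iUnion fun t => ?_).subset hsub
      exact (hfin _ z).preimage (Prod.mk_right_injective (sep z t)).injOn
  have hsplit {z w : Q} (hzw : ¬ R.BEquiv z w) (x u : Q) :
      F x z u w = (delta A x u - delta A (R.act x z) (R.act u w)) * b z w := by
    have hbzw : b z w = F (sep z (R.rho w)) z (sep z (R.rho w)) w := if_neg hzw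
    rw [hbzw]
    have hne := hsep z w hzw
    generalize sep z (R.rho w) = y at hne
    obtain ⟨x, rfl⟩ := (R.act_bijective y).2 x
    obtain ⟨u, rfl⟩ := (R.act_bijective y).2 u
    have h := hB x y z u y w
    rw [delta_self, delta_of_ne hne] at h
    simp only
    rw [delta_congr (A := A) (R.act_right_inj x u y)]
    linear_combination h
  have hbsymm {g : Equiv.Perm Q} (hg : g ∈ R.Inn) (z w : Q) : b (g z) (g w) = b z w := by
    by_cases hzw : R.BEquiv z w
    · simp only [hb, bEquiv_map_iff R hg, if_pos hzw]
    · obtain ⟨y, hy⟩ := R.exists_act_ne hzw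
      have hzw' := (not_congr (R.bEquiv_map_iff hg z w)).mpr hzw
      have h1 := hsplit hzw y y
      have h2 := hsplit hzw' (g y) (g y)
      have h3 : F (g y) (g z) (g y) (g w) = F y z y w :=
        congrFun (congrFun (congrFun (congrFun (heq g hg) y) z) y) w
      rw [delta_self, delta_of_ne hy] at h1
      rw [← R.Inn_map_act hg, ← R.Inn_map_act hg, delta_self,
        delta_of_ne (g.injective.ne hy), h3] at h2
      linear_combination h1 - h2
  have hval (x y u v : Q) :
      (F + R.coboundary A b) x y u v = if R.BEquiv y v then F x y u v else 0 := by
    rw [Pi.add_apply, Pi.add_apply, Pi.add_apply, Pi.add_apply, coboundary_apply]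
    have hinv : delta A y v * (b (R.act x y) (R.act u v) - b x u) = 0 := by
      by_cases hyv : y = v
      · subst hyv
        have := hbsymm (R.rho_mem_Inn y) x u
        rw [show b (R.act x y) (R.act u y) = b x u from this, sub_self, mul_zero]
      · rw [delta_of_ne hyv, zero_mul]
    rw [hinv]
    split_ifs with hyv
    · simp only [hb, if_pos hyv, mul_zero, add_zero]
    · rw [hsplit hyv]
      ring
  have hquasi {y v : Q} (hyv : ¬ R.BEquiv y v) {z w : Q} (hzw : R.BEquiv z w) :
      F y z v w = 0 := by
    obtain ⟨x, hx⟩ := R.exists_act_ne hyv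
    have hyv' : y ≠ v := fun h => hyv (h ▸ rfl)
    have h := hB x y z x v w
    rw [bEquiv_iff] at hzw
    rw [← hzw, ← hzw, delta_of_ne hyv', delta_of_ne ((R.act_right_inj _ _ z).not.mpr hx),
      delta_of_ne ((R.act_right_inj _ _ z).not.mpr hyv'), delta_self] at h
    linear_combination -h
  have hleft {z w : Q} (hzw : R.BEquiv z w) {g : Equiv.Perm Q} (hg : g ∈ R.Inn) (x u : Q) :
      F (g x) z (g u) w = F x z u w := by
    induction hg using Subgroup.closure_induction generalizing x u with
    | mem g hg =>
      obtain ⟨y, rfl⟩ := hg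
      have h := hB x y z u y w
      rw [bEquiv_iff] at hzw
      rw [← hzw, ← hzw, delta_self, delta_self, delta_congr (A := A) (R.act_right_inj _ _ z),
        delta_congr (A := A) (R.act_right_inj _ _ y)] at h
      change F (R.act x y) z (R.act u y) w = F x z u w
      linear_combination h
    | one => rfl
    | mul g h _ _ ihg ihh => simp only [Equiv.Perm.mul_apply, ihg, ihh]
    | inv g _ ih => simpa using (ih (g⁻¹ x) (g⁻¹ u)).symm
  refine ⟨b, hbmem, fun x y u v h => ?_, fun x y u v α β => ?_⟩
  · rw [hval]
    split_ifs with hyv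
    · exact hquasi (h.resolve_right (not_not_intro hyv)) hyv
    · rfl
  · rw [hval, hval]
    simp only [bEquiv_map_iff R β.2]
    split_ifs with hyv
    · have h1 : F ((β : Equiv.Perm Q) x) ((β : Equiv.Perm Q) y) ((β : Equiv.Perm Q) u)
          ((β : Equiv.Perm Q) v) = F x y u v :=
        congrFun (congrFun (congrFun (congrFun (heq β β.2) x) y) u) v
      rw [← h1]
      have h2 := hleft ((R.bEquiv_map_iff β.2 y v).mpr hyv) (mul_mem α.2 (inv_mem β.2))
        ((β : Equiv.Perm Q) x) ((β : Equiv.Perm Q) u)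
      simpa using h2
    · rfl

end Cochains

end YBRack

section Small

variable {A M N P : Type*} [CommRing A] [AddCommMonoid M] [Module A M] [AddCommMonoid N]
  [Module A N] [AddCommMonoid P] [Module A P] {m : Ideal A}

/-- A linear map is small with respect to `m` if it vanishes modulo `m`. -/
def IsSmall (m : Ideal A) (T : M →ₗ[A] N) : Prop := ∀ x, T x ∈ m • (⊤ : Submodule A N)

theorem map_mem_smul_top (S : N →ₗ[A] P) {x : N} (hx : x ∈ m • (⊤ : Submodule A N)) :
    S x ∈ m • (⊤ : Submodule A P) :=
  Submodule.smul_top_le_comap_smul_top m S hx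

theorem IsSmall.comp_left {T : M →ₗ[A] N} (hT : IsSmall m T) (S : N →ₗ[A] P) :
    IsSmall m (S ∘ₗ T) := fun x => map_mem_smul_top S (hT x)

theorem IsSmall.comp_right {T : N →ₗ[A] P} (hT : IsSmall m T) (S : M →ₗ[A] N) :
    IsSmall m (T ∘ₗ S) := fun x => hT (S x)

theorem IsSmall.add {S T : M →ₗ[A] N} (hS : IsSmall m S) (hT : IsSmall m T) :
    IsSmall m (S + T) := fun x => add_mem (hS x) (hT x)

theorem IsSmall.sub {M N : Type*} [AddCommGroup M] [Module A M] [AddCommGroup N] [Module A N]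
    {S T : M →ₗ[A] N} (hS : IsSmall m S) (hT : IsSmall m T) :
    IsSmall m (S - T) := fun x => sub_mem (hS x) (hT x)

theorem IsSmall.comp_eq_zero (hm : m * m = ⊥) {S : N →ₗ[A] P} {T : M →ₗ[A] N}
    (hS : IsSmall m S) (hT : IsSmall m T) : S ∘ₗ T = 0 := by
  ext x
  have h : (m • (⊤ : Submodule A N)).map S ≤ ⊥ := by
    have hmm : m • m • (⊤ : Submodule A P) = ⊥ := by
      rw [← Submodule.mul_smul, hm, Submodule.bot_smul]
    rw [Submodule.map_smul'', ← hmm]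
    refine Submodule.smul_mono le_rfl ?_
    rintro _ ⟨y, -, rfl⟩
    exact hS y
  exact h ⟨T x, hT x, rfl⟩

theorem IsSmall.mul_eq_zero (hm : m * m = ⊥) {S T : Module.End A M}
    (hS : IsSmall m S) (hT : IsSmall m T) : S * T = 0 := hS.comp_eq_zero hm hT

theorem IsSmall.mul_mul_eq_zero (hm : m * m = ⊥) {S T : Module.End A M}
    (hS : IsSmall m S) (hT : IsSmall m T) (X : Module.End A M) : S * X * T = 0 :=
  (hS.comp_right X).comp_eq_zero hm hT

theorem IsSmall.rTensor {T : M →ₗ[A] N} (hT : IsSmall m T) :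
    IsSmall m (LinearMap.rTensor P T) := by
  intro t
  induction t with
  | zero => simp
  | add s t hs ht => rw [map_add]; exact add_mem hs ht
  | tmul x y => exact map_mem_smul_top (LinearMap.flip (TensorProduct.mk A N P) y) (hT x)

theorem IsSmall.lTensor {T : M →ₗ[A] N} (hT : IsSmall m T) :
    IsSmall m (LinearMap.lTensor P T) := by
  intro t
  induction t with
  | zero => simp
  | add s t hs ht => rw [map_add]; exact add_mem hs ht
  | tmul x y => exact map_mem_smul_top (TensorProduct.mk A P N x) (hT y)

theorem Finsupp.mem_ideal_smul_top_iff {ι : Type*} (v : ι →₀ A) :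
    v ∈ m • (⊤ : Submodule A (ι →₀ A)) ↔ ∀ i, v i ∈ m := by
  refine ⟨fun h i => ?_, fun h => ?_⟩
  · have := map_mem_smul_top (Finsupp.lapply i : (ι →₀ A) →ₗ[A] A) h
    simpa using this
  · rw [← Finsupp.sum_single v]
    refine sum_mem fun i _ => ?_
    rw [← mul_one (v i), ← smul_eq_mul, ← Finsupp.smul_single]
    exact Submodule.smul_mem_smul (h i) trivial

theorem isSmall_of_basis {ι : Type*} (b : Module.Basis ι A M) {T : M →ₗ[A] N}
    (h : ∀ i, T (b i) ∈ m • (⊤ : Submodule A N)) : IsSmall m T := by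
  intro x
  have : (⊤ : Submodule A M) ≤ (m • (⊤ : Submodule A N)).comap T := by
    rw [← b.span_eq, Submodule.span_le]
    rintro _ ⟨i, rfl⟩
    exact h i
  exact this trivial

/-- `1 + T` as an automorphism, for `T` small with respect to an ideal of square zero. -/
def IsSmall.equivOneAdd {M : Type*} [AddCommGroup M] [Module A M] (hm : m * m = ⊥)
    {T : Module.End A M} (hT : IsSmall m T) : M ≃ₗ[A] M :=
  LinearEquiv.ofLinearMap (1 + T) (1 - T)
    (by
      change (1 + T) * (1 - T) = 1
      rw [add_mul, mul_sub T, hT.mul_eq_zero hm hT]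
      noncomm_ring)
    (by
      change (1 - T) * (1 + T) = 1
      rw [sub_mul, mul_add T, hT.mul_eq_zero hm hT]
      noncomm_ring)

end Small

section Linearization

/-- First-order part of the braid equation. -/
theorem linearize_braid {E : Type*} [Ring E] {C₁ C₂ F₁ F₂ : E}
    (h : C₁ * C₂ * C₁ = C₂ * C₁ * C₂)
    (h₁₁ : ∀ X, F₁ * X * F₁ = 0) (h₁₂ : ∀ X, F₁ * X * F₂ = 0)
    (h₂₁ : ∀ X, F₂ * X * F₁ = 0) (h₂₂ : ∀ X, F₂ * X * F₂ = 0)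
    (hyb : C₁ * (1 + F₁) * (C₂ * (1 + F₂)) * (C₁ * (1 + F₁))
      = C₂ * (1 + F₂) * (C₁ * (1 + F₁)) * (C₂ * (1 + F₂))) :
    C₁ * C₂ * C₁ * F₁ + C₁ * C₂ * F₂ * C₁ + C₁ * F₁ * C₂ * C₁
      = C₂ * C₁ * C₂ * F₂ + C₂ * C₁ * F₁ * C₂ + C₂ * F₂ * C₁ * C₂ := by
  have expand (C D F G : E) (h₁ : F * D * G = 0) (h₂ : G * C * F = 0)
      (h₃ : F * (D * C) * F = 0) : C * (1 + F) * (D * (1 + G)) * (C * (1 + F))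
      = C * D * C + (C * D * C * F + C * D * G * C + C * F * D * C) := by
    have : C * (1 + F) * (D * (1 + G)) * (C * (1 + F))
      = C * D * C + (C * D * C * F + C * D * G * C + C * F * D * C)
        + C * (F * D * G) * (C * (1 + F)) + C * D * (G * C * F) + C * (F * (D * C) * F) := by
      noncomm_ring
    rw [this, h₁, h₂, h₃]
    simp
  rw [expand _ _ _ _ (h₁₂ _) (h₂₁ _) (h₁₁ _), expand _ _ _ _ (h₂₁ _) (h₁₂ _) (h₂₂ _), h] at hyb
  rw [h]
  exact add_left_cancel hyb

variable {A M : Type*} [CommRing A] [AddCommMonoid M] [Module A M]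

/-- The operator `c ⊗ id`. -/
def onLeft (c : Module.End A (M ⊗[A] M)) : Module.End A ((M ⊗[A] M) ⊗[A] M) :=
  LinearMap.rTensor M c

/-- The operator `id ⊗ c`. -/
def onRight (c : Module.End A (M ⊗[A] M)) : Module.End A ((M ⊗[A] M) ⊗[A] M) :=
  (TensorProduct.assoc A M M M).symm.toLinearMap ∘ₗ (LinearMap.lTensor M c) ∘ₗ
    (TensorProduct.assoc A M M M).toLinearMap

theorem yBE_iff {M : Type*} [AddCommGroup M] [Module A M] (c : Module.End A (M ⊗[A] M)) :
    YBE c ↔ onLeft c * onRight c * onLeft c = onRight c * onLeft c * onRight c := Iff.rfl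

theorem onLeft_tmul (c : Module.End A (M ⊗[A] M)) (s : M ⊗[A] M) (z : M) :
    onLeft c (s ⊗ₜ z) = c s ⊗ₜ z := rfl

theorem onRight_tmul (c : Module.End A (M ⊗[A] M)) (x y z : M) :
    onRight c (x ⊗ₜ y ⊗ₜ z) = (TensorProduct.assoc A M M M).symm (x ⊗ₜ c (y ⊗ₜ z)) := rfl

theorem onLeft_mul_one_add (c f : Module.End A (M ⊗[A] M)) :
    onLeft (c * (1 + f)) = onLeft c * (1 + onLeft f) := by
  refine TensorProduct.ext' fun s z => ?_
  simp [onLeft_tmul, TensorProduct.add_tmul]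

theorem onRight_mul_one_add (c f : Module.End A (M ⊗[A] M)) :
    onRight (c * (1 + f)) = onRight c * (1 + onRight f) := by
  refine LinearMap.ext fun t => ?_
  simp [onRight, LinearMap.lTensor_mul, LinearMap.lTensor_add, Module.End.one_eq_id]

theorem IsSmall.onLeft {m : Ideal A} {f : Module.End A (M ⊗[A] M)} (hf : IsSmall m f) :
    IsSmall m (onLeft f) := hf.rTensor

theorem IsSmall.onRight {m : Ideal A} {f : Module.End A (M ⊗[A] M)} (hf : IsSmall m f) :
    IsSmall m (onRight f) := (hf.lTensor.comp_right _).comp_left _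

/-- The infinitesimal action of `a` on `M ⊗ M`. -/
def infAct (a : Module.End A M) : Module.End A (M ⊗[A] M) :=
  LinearMap.rTensor M a + LinearMap.lTensor M a

theorem infAct_tmul (a : Module.End A M) (x y : M) :
    infAct a (x ⊗ₜ y) = a x ⊗ₜ y + x ⊗ₜ a y := rfl

theorem IsSmall.infAct {m : Ideal A} {a : Module.End A M} (ha : IsSmall m a) :
    IsSmall m (infAct a) := ha.rTensor.add ha.lTensor

theorem map_one_add {m : Ideal A} (hm : m * m = ⊥) {a : Module.End A M} (ha : IsSmall m a) :
    TensorProduct.map (1 + a) (1 + a) = 1 + infAct a := by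
  refine TensorProduct.ext' fun x y => ?_
  have h : a x ⊗ₜ a y = (0 : M ⊗[A] M) :=
    LinearMap.congr_fun ((ha.rTensor (P := M)).comp_eq_zero hm (ha.lTensor (P := M))) (x ⊗ₜ[A] y)
  simp [infAct_tmul, TensorProduct.add_tmul, TensorProduct.tmul_add, h]
  abel

/-- First-order part of the Yang–Baxter equation for a deformation `c (1 + f)`. -/
theorem YBE.linearize {M : Type*} [AddCommGroup M] [Module A M] {m : Ideal A}
    (hm : m * m = ⊥) {c f : Module.End A (M ⊗[A] M)}
    (hc : onLeft c * onRight c * onLeft c = onRight c * onLeft c * onRight c)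
    (hf : IsSmall m f) (hyb : YBE (c * (1 + f))) :
    onLeft c * onRight c * onLeft c * onLeft f + onLeft c * onRight c * onRight f * onLeft c
        + onLeft c * onLeft f * onRight c * onLeft c
      = onRight c * onLeft c * onRight c * onRight f
        + onRight c * onLeft c * onLeft f * onRight c
        + onRight c * onRight f * onLeft c * onRight c := by
  rw [yBE_iff, onLeft_mul_one_add, onRight_mul_one_add] at hyb
  exact linearize_braid (E := Module.End A ((M ⊗[A] M) ⊗[A] M)) (C₁ := onLeft c)
    (C₂ := onRight c) (F₁ := onLeft f) (F₂ := onRight f) hc (hf.onLeft.mul_mul_eq_zero hm hf.onLeft)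
    (hf.onLeft.mul_mul_eq_zero hm hf.onRight) (hf.onRight.mul_mul_eq_zero hm hf.onLeft)
    (hf.onRight.mul_mul_eq_zero hm hf.onRight) hyb

/-- Conjugation of a first-order deformation, to first order. -/
theorem conj_iff {M : Type*} [AddCommGroup M] [Module A M] {m : Ideal A} (hm : m * m = ⊥)
    {c f g : Module.End A (M ⊗[A] M)} {a : Module.End A M}
    (hf : IsSmall m f) (hg : IsSmall m g) (ha : IsSmall m a) :
    c * (1 + f) * (1 + infAct a) = (1 + infAct a) * (c * (1 + g))
      ↔ c * f + c * infAct a = infAct a * c + c * g := by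
  have h₁ : c * (1 + f) * (1 + infAct a) = c + (c * f + c * infAct a) := by
    rw [mul_assoc, add_mul, mul_add f, hf.mul_eq_zero hm ha.infAct]
    noncomm_ring
  have h₂ : (1 + infAct a) * (c * (1 + g)) = c + (infAct a * c + c * g) := by
    have := ha.infAct.mul_mul_eq_zero hm hg c
    calc _ = c + (infAct a * c + c * g) + infAct a * c * g := by noncomm_ring
      _ = _ := by rw [this, add_zero]
  rw [h₁, h₂, add_right_inj]

end Linearization

section Coefficients

variable {A Q : Type*} [CommRing A]

/-- The coefficient of `u ⊗ v`. -/
def coef₂ (A : Type*) [CommRing A] {Q : Type*} (u v : Q) : ((Q →₀ A) ⊗[A] (Q →₀ A)) →ₗ[A] A :=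
  Finsupp.lapply (u, v) ∘ₗ (finsuppTensorFinsupp' A Q Q).toLinearMap

/-- The coefficient of `u ⊗ v ⊗ w`. -/
def coef₃ (A : Type*) [CommRing A] {Q : Type*} (u v w : Q) :
    (((Q →₀ A) ⊗[A] (Q →₀ A)) ⊗[A] (Q →₀ A)) →ₗ[A] A :=
  Finsupp.lapply ((u, v), w) ∘ₗ (finsuppTensorFinsupp' A (Q × Q) Q).toLinearMap ∘ₗ
    LinearMap.rTensor _ (finsuppTensorFinsupp' A Q Q).toLinearMap

theorem coef₂_tmul (u v : Q) (a b : Q →₀ A) : coef₂ A u v (a ⊗ₜ b) = a u * b v :=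
  finsuppTensorFinsupp'_apply_apply ..

theorem coef₃_tmul (u v w : Q) (s : (Q →₀ A) ⊗[A] (Q →₀ A)) (b : Q →₀ A) :
    coef₃ A u v w (s ⊗ₜ b) = coef₂ A u v s * b w :=
  finsuppTensorFinsupp'_apply_apply ..

theorem coef₃_assoc_symm (u v w : Q) (a : Q →₀ A) (s : (Q →₀ A) ⊗[A] (Q →₀ A)) :
    coef₃ A u v w ((TensorProduct.assoc A _ _ _).symm (a ⊗ₜ s)) = a u * coef₂ A v w s := by
  induction s with
  | zero => simp
  | add s t hs ht => simp only [TensorProduct.tmul_add, map_add, hs, ht, mul_add]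
  | tmul b c => simp only [TensorProduct.assoc_symm_tmul, coef₃_tmul, coef₂_tmul, mul_assoc]

theorem mat2_apply (f : Module.End A ((Q →₀ A) ⊗[A] (Q →₀ A))) (x y u v : Q) :
    mat2 A f (x, y) (u, v)
      = coef₂ A u v (f (Finsupp.single x 1 ⊗ₜ Finsupp.single y 1)) := by
  rw [mat2, finsuppTensorFinsupp'_symm_single_eq_single_one_tmul]
  rfl

theorem single_one_apply (x u : Q) : Finsupp.single x (1 : A) u = YBRack.delta A x u := by
  classical
  rw [Finsupp.single_apply]
  by_cases h : x = u
  · rw [if_pos h, YBRack.delta, if_pos h]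
  · rw [if_neg h, YBRack.delta, if_neg h]

theorem mat2_injective {f g : Module.End A ((Q →₀ A) ⊗[A] (Q →₀ A))}
    (h : ∀ x y u v, mat2 A f (x, y) (u, v) = mat2 A g (x, y) (u, v)) : f = g := by
  refine LinearMap.ext fun t => ?_
  obtain ⟨t, rfl⟩ := (finsuppTensorFinsupp' A Q Q).symm.surjective t
  refine LinearMap.congr_fun (f := f ∘ₗ (finsuppTensorFinsupp' A Q Q).symm.toLinearMap)
    (g := g ∘ₗ (finsuppTensorFinsupp' A Q Q).symm.toLinearMap) ?_ t
  refine Finsupp.lhom_ext' fun p => LinearMap.ext_ring ?_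
  apply (finsuppTensorFinsupp' A Q Q).injective
  ext q
  exact h p.1 p.2 q.1 q.2

theorem isSmall_iff_mat2 {m : Ideal A} (f : Module.End A ((Q →₀ A) ⊗[A] (Q →₀ A))) :
    IsSmall m f ↔ ∀ p q, mat2 A f p q ∈ m := by
  have e : IsSmall m f ↔ IsSmall m ((finsuppTensorFinsupp' A Q Q).toLinearMap ∘ₗ f) := by
    refine ⟨fun h => h.comp_left _, fun h => ?_⟩
    convert h.comp_left (finsuppTensorFinsupp' A Q Q).symm.toLinearMap
    ext1
    simp
  rw [e]
  refine ⟨fun h p q => (Finsupp.mem_ideal_smul_top_iff _).mp (h _) q, fun h => ?_⟩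
  refine isSmall_of_basis (Module.Basis.ofRepr (finsuppTensorFinsupp' A Q Q)) fun p => ?_
  rw [Finsupp.mem_ideal_smul_top_iff]
  exact h p

theorem isSmall_iff_mat1 {m : Ideal A} (a : Module.End A (Q →₀ A)) :
    IsSmall m a ↔ ∀ x u, mat1 A a x u ∈ m := by
  refine ⟨fun h x u => (Finsupp.mem_ideal_smul_top_iff _).mp (h _) u, fun h => ?_⟩
  refine isSmall_of_basis Finsupp.basisSingleOne fun x => ?_
  rw [Finsupp.mem_ideal_smul_top_iff, Finsupp.coe_basisSingleOne]
  exact h x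

/-- Every row-finite matrix is the matrix of an endomorphism. -/
theorem YBRack.exists_mat1_eq {m : Ideal A} {a : Q → Q → A} (ha : a ∈ YBRack.rowFinite Q m) :
    ∃ T : Module.End A (Q →₀ A), IsSmall m T ∧ mat1 A T = a := by
  have h : mat1 A (Finsupp.linearCombination A fun x =>
      Finsupp.ofSupportFinite (a x) (ha.2 x)) = a := by
    funext x u
    simp [mat1, Finsupp.linearCombination_single, Finsupp.ofSupportFinite_coe]
  exact ⟨_, (isSmall_iff_mat1 _).mpr fun x u => by rw [h]; exact ha.1 x u, h⟩

end Coefficients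

namespace YBRack

section Operator

variable {A Q : Type*} [CommRing A] {R : YBRack Q}
  {cQ : Module.End A ((Q →₀ A) ⊗[A] (Q →₀ A))}

/-- The permutation `(x, y) ↦ (y, x ^ y)`. -/
def braidEquiv (R : YBRack Q) : Q × Q ≃ Q × Q :=
  (Equiv.prodComm Q Q).trans (Equiv.prodShear (Equiv.refl Q) R.rho)

/-- The operator `c_Q`. -/
def IsBraiding (R : YBRack Q) (cQ : Module.End A ((Q →₀ A) ⊗[A] (Q →₀ A))) : Prop :=
  ∀ x y : Q, cQ (Finsupp.single x (1 : A) ⊗ₜ[A] Finsupp.single y (1 : A))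
    = Finsupp.single y (1 : A) ⊗ₜ[A] Finsupp.single (R.act x y) (1 : A)

theorem IsBraiding.exists_mul_eq_one (hcQ : R.IsBraiding cQ) :
    ∃ d : Module.End A ((Q →₀ A) ⊗[A] (Q →₀ A)), cQ * d = 1 := by
  let e := finsuppTensorFinsupp' A Q Q ≪≫ₗ Finsupp.domLCongr R.braidEquiv ≪≫ₗ
    (finsuppTensorFinsupp' A Q Q).symm
  have he : cQ = e.toLinearMap := by
    ext x y : 7
    simp [hcQ x y, e, braidEquiv, finsuppTensorFinsupp'_symm_single_eq_single_one_tmul]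
    rfl
  refine ⟨e.symm.toLinearMap, ?_⟩
  rw [he]
  refine LinearMap.ext fun t => ?_
  simp

theorem IsBraiding.coef₂_apply (hcQ : R.IsBraiding cQ) (u v : Q)
    (t : (Q →₀ A) ⊗[A] (Q →₀ A)) : coef₂ A v (R.act u v) (cQ t) = coef₂ A u v t := by
  refine LinearMap.congr_fun (f := coef₂ A v (R.act u v) ∘ₗ cQ) ?_ t
  ext x y : 5
  simp only [LinearMap.coe_comp, Function.comp_apply, TensorProduct.AlgebraTensorModule.curry_apply,
    TensorProduct.curry_apply, LinearMap.coe_restrictScalars, Finsupp.lsingle_apply, hcQ x y,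
    coef₂_tmul, single_one_apply]
  by_cases h : y = v
  · subst h
    rw [delta_congr (A := A) (R.act_right_inj x u y), mul_comm]
  · simp [delta_of_ne h]

theorem IsBraiding.coef₃_onLeft (hcQ : R.IsBraiding cQ) (u v w : Q)
    (t : ((Q →₀ A) ⊗[A] (Q →₀ A)) ⊗[A] (Q →₀ A)) :
    coef₃ A v (R.act u v) w (onLeft cQ t) = coef₃ A u v w t := by
  refine LinearMap.congr_fun (f := coef₃ A v (R.act u v) w ∘ₗ onLeft cQ) ?_ t
  refine TensorProduct.ext' fun s b => ?_
  simp [onLeft_tmul, coef₃_tmul, hcQ.coef₂_apply]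

theorem IsBraiding.coef₃_onRight (hcQ : R.IsBraiding cQ) (u v w : Q)
    (t : ((Q →₀ A) ⊗[A] (Q →₀ A)) ⊗[A] (Q →₀ A)) :
    coef₃ A u w (R.act v w) (onRight cQ t) = coef₃ A u v w t := by
  refine LinearMap.congr_fun (f := coef₃ A u w (R.act v w) ∘ₗ onRight cQ) ?_ t
  refine TensorProduct.ext_threefold fun a b c => ?_
  simp [onRight_tmul, coef₃_assoc_symm, hcQ.coef₂_apply, coef₂_tmul, coef₃_tmul, mul_assoc]

theorem IsBraiding.onLeft_single (hcQ : R.IsBraiding cQ) (x y z : Q) :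
    onLeft cQ (Finsupp.single x 1 ⊗ₜ Finsupp.single y 1 ⊗ₜ Finsupp.single z 1)
      = Finsupp.single y 1 ⊗ₜ Finsupp.single (R.act x y) 1 ⊗ₜ Finsupp.single z 1 := by
  rw [onLeft_tmul, hcQ]

theorem IsBraiding.onRight_single (hcQ : R.IsBraiding cQ) (x y z : Q) :
    onRight cQ (Finsupp.single x 1 ⊗ₜ Finsupp.single y 1 ⊗ₜ Finsupp.single z 1)
      = Finsupp.single x 1 ⊗ₜ Finsupp.single z 1 ⊗ₜ Finsupp.single (R.act y z) 1 := by
  rw [onRight_tmul, hcQ, TensorProduct.assoc_symm_tmul]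

theorem coef₃_onLeft_single (f : Module.End A ((Q →₀ A) ⊗[A] (Q →₀ A))) (x y z u v w : Q) :
    coef₃ A u v w
      (onLeft f (Finsupp.single x 1 ⊗ₜ Finsupp.single y 1 ⊗ₜ Finsupp.single z 1))
      = delta A z w * mat2 A f (x, y) (u, v) := by
  rw [onLeft_tmul, coef₃_tmul, ← mat2_apply, single_one_apply, mul_comm]

theorem coef₃_onRight_single (f : Module.End A ((Q →₀ A) ⊗[A] (Q →₀ A))) (x y z u v w : Q) :
    coef₃ A u v w
      (onRight f (Finsupp.single x 1 ⊗ₜ Finsupp.single y 1 ⊗ₜ Finsupp.single z 1))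
      = delta A x u * mat2 A f (y, z) (v, w) := by
  rw [onRight_tmul, coef₃_assoc_symm, ← mat2_apply, single_one_apply]

theorem IsBraiding.braid (hcQ : R.IsBraiding cQ) :
    onLeft cQ * onRight cQ * onLeft cQ = onRight cQ * onLeft cQ * onRight cQ := by
  ext x y z : 9
  change onLeft cQ (onRight cQ (onLeft cQ
      (Finsupp.single x 1 ⊗ₜ Finsupp.single y 1 ⊗ₜ Finsupp.single z 1)))
    = onRight cQ (onLeft cQ (onRight cQ
      (Finsupp.single x 1 ⊗ₜ Finsupp.single y 1 ⊗ₜ Finsupp.single z 1)))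
  simp only [hcQ.onLeft_single, hcQ.onRight_single, ← R.self_distrib]

/-- The matrix of an endomorphism of `AQ ⊗ AQ`, in curried form. -/
def matrix (f : Module.End A ((Q →₀ A) ⊗[A] (Q →₀ A))) (x y u v : Q) : A :=
  mat2 A f (x, y) (u, v)

/-- First-order Yang–Baxter deformations are cocycles. -/
theorem IsBraiding.matrix_mem_cocycles (hcQ : R.IsBraiding cQ) {m : Ideal A}
    (hm : m * m = ⊥) {f : Module.End A ((Q →₀ A) ⊗[A] (Q →₀ A))} (hf : IsSmall m f)
    (hyb : YBE (cQ * (1 + f))) : matrix f ∈ R.cocycles A := by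
  have h := YBE.linearize hm hcQ.braid hf hyb
  intro x y z u v w
  have h := congrArg (coef₃ A w (R.act v w) (R.act (R.act u v) w)) (LinearMap.congr_fun h
    (Finsupp.single x 1 ⊗ₜ Finsupp.single y 1 ⊗ₜ Finsupp.single z 1))
  simp only [LinearMap.add_apply, Module.End.mul_apply, map_add, hcQ.onLeft_single,
    hcQ.onRight_single, hcQ.coef₃_onLeft, hcQ.coef₃_onRight, coef₃_onLeft_single,
    coef₃_onRight_single] at h
  simp only [R.self_distrib u v w, hcQ.coef₃_onLeft, hcQ.coef₃_onRight, coef₃_onLeft_single,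
    coef₃_onRight_single] at h
  simp only [matrix, R.self_distrib u v w]
  exact h

theorem coef₂_infAct_single (a : Module.End A (Q →₀ A)) (x y u v : Q) :
    coef₂ A u v (infAct a (Finsupp.single x 1 ⊗ₜ Finsupp.single y 1))
      = mat1 A a x u * delta A y v + delta A x u * mat1 A a y v := by
  rw [infAct_tmul, map_add, coef₂_tmul, coef₂_tmul, single_one_apply, single_one_apply]
  rfl

theorem IsBraiding.matrix_eq_add_coboundary (hcQ : R.IsBraiding cQ)
    {f g : Module.End A ((Q →₀ A) ⊗[A] (Q →₀ A))} {a : Module.End A (Q →₀ A)}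
    (h : cQ * f + cQ * infAct a = infAct a * cQ + cQ * g) :
    matrix f = matrix g + R.coboundary A (mat1 A a) := by
  funext x y u v
  have h := congrArg (coef₂ A v (R.act u v)) (LinearMap.congr_fun h
    (Finsupp.single x 1 ⊗ₜ Finsupp.single y 1))
  simp only [LinearMap.add_apply, Module.End.mul_apply, map_add, hcQ.coef₂_apply, hcQ x y,
    coef₂_infAct_single] at h
  rw [Pi.add_apply, Pi.add_apply, Pi.add_apply, Pi.add_apply, coboundary_apply]
  simp only [matrix, mat2_apply]
  linear_combination h

end Operator

end YBRack

section Classification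

set_option maxSynthPendingDepth 3

variable {A Q : Type*} [CommRing A] {R : YBRack Q} {m : Ideal A}

theorem ite_eq_delta {P : Type*} (x u : P) [Decidable (x = u)] :
    (if x = u then (1 : A) else 0) = YBRack.delta A x u := by
  by_cases h : x = u
  · rw [if_pos h, YBRack.delta, if_pos h]
  · rw [if_neg h, YBRack.delta, if_neg h]

theorem mat2_one (p q : Q × Q) :
    mat2 A (1 : Module.End A ((Q →₀ A) ⊗[A] (Q →₀ A))) p q = YBRack.delta A p q := by
  rw [mat2, ← single_one_apply, Module.End.one_apply, LinearEquiv.apply_symm_apply]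

theorem mat2_add (f g : Module.End A ((Q →₀ A) ⊗[A] (Q →₀ A))) (p q : Q × Q) :
    mat2 A (f + g) p q = mat2 A f p q + mat2 A g p q := by
  simp [mat2]

theorem mat2_sub (f g : Module.End A ((Q →₀ A) ⊗[A] (Q →₀ A))) (p q : Q × Q) :
    mat2 A (f - g) p q = mat2 A f p q - mat2 A g p q := by
  simp [mat2]

theorem entropic2_one_add_iff (f : Module.End A ((Q →₀ A) ⊗[A] (Q →₀ A))) :
    Entropic2 R A (1 + f) ↔ R.IsEntropicMatrix (YBRack.matrix f) := by
  refine and_congr ?_ ?_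
  · refine forall₄_congr fun x y u v => imp_congr_right fun h => ?_
    have hne : (x, y) ≠ (u, v) := by
      rintro ⟨⟩
      exact h.elim (fun h => h rfl) (fun h => h rfl)
    rw [mat2_add, mat2_one, YBRack.delta_of_ne hne, zero_add]
    rfl
  · refine forall₄_congr fun x y u v => forall₂_congr fun α β => ?_
    rw [mat2_add, mat2_add, mat2_one, mat2_one,
      YBRack.delta_congr (A := A) (y := (x, y)) (v := (u, v)) (by simp), add_right_inj]
    rfl

theorem yBEquivalent_iff (hm : m * m = ⊥)
    {c c' : Module.End A ((Q →₀ A) ⊗[A] (Q →₀ A))} :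
    YBEquivalent m c c' ↔ ∃ a : Module.End A (Q →₀ A), IsSmall m a ∧
      c' * (1 + infAct a) = (1 + infAct a) * c := by
  have conj (α : (Q →₀ A) ≃ₗ[A] (Q →₀ A)) (a : Module.End A (Q →₀ A)) (ha : IsSmall m a)
      (h : α.toLinearMap = 1 + a) : c' = (TensorProduct.congr α α).toLinearMap ∘ₗ c ∘ₗ
        (TensorProduct.congr α α).symm.toLinearMap
        ↔ c' * (1 + infAct a) = (1 + infAct a) * c := by
    have e : (TensorProduct.congr α α).toLinearMap = 1 + infAct a := by
      rw [← map_one_add hm ha, ← h]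
      rfl
    rw [← e, ← LinearMap.comp_assoc, LinearEquiv.eq_comp_toLinearMap_symm]
    rfl
  constructor
  · rintro ⟨α, hα, h⟩
    have hsub : α.toLinearMap = 1 + (α.toLinearMap - 1) := by abel
    have ha : IsSmall m (α.toLinearMap - 1) := by
      rw [isSmall_iff_mat1]
      intro x u
      have := hα x u
      rwa [ite_eq_delta, ← single_one_apply] at this
    exact ⟨_, ha, (conj α _ ha hsub).mp h⟩
  · rintro ⟨a, ha, h⟩
    refine ⟨ha.equivOneAdd hm, fun x u => ?_, (conj _ a ha rfl).mpr h⟩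
    have e : (ha.equivOneAdd hm) (Finsupp.single x 1)
        = Finsupp.single x 1 + a (Finsupp.single x 1) := rfl
    rw [e, ite_eq_delta, ← single_one_apply, Finsupp.add_apply, add_sub_cancel_left]
    exact (isSmall_iff_mat1 a).mp ha x u

open scoped Classical in
theorem isSmall_sub_one_iff (f : Module.End A ((Q →₀ A) ⊗[A] (Q →₀ A))) :
    IsSmall m (f - 1) ↔ ∀ p q : Q × Q, mat2 A f p q - (if p = q then 1 else 0) ∈ m := by
  simp only [isSmall_iff_mat2, mat2_sub, mat2_one, ite_eq_delta]

theorem YBRack.finite_support_matrix (f : Module.End A ((Q →₀ A) ⊗[A] (Q →₀ A))) (x y : Q) :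
    (Function.support fun p : Q × Q => matrix f x y p.1 p.2).Finite :=
  (finsuppTensorFinsupp' A Q Q
    (f ((finsuppTensorFinsupp' A Q Q).symm (Finsupp.single (x, y) 1)))).hasFiniteSupport

/-- The gauge transformation `1 + T` carries first-order deformations to such. -/
theorem YBRack.IsBraiding.exists_gauge {cQ : Module.End A ((Q →₀ A) ⊗[A] (Q →₀ A))}
    (hcQ : R.IsBraiding cQ) {f : Module.End A ((Q →₀ A) ⊗[A] (Q →₀ A))} (hf : IsSmall m f)
    {T : Module.End A (Q →₀ A)} (hT : IsSmall m T) :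
    ∃ g : Module.End A ((Q →₀ A) ⊗[A] (Q →₀ A)), IsSmall m g ∧
      cQ * f + cQ * infAct T = infAct T * cQ + cQ * g := by
  obtain ⟨d, hd⟩ := hcQ.exists_mul_eq_one
  refine ⟨f + (infAct T - d * (infAct T * cQ)),
    hf.add (hT.infAct.sub ((hT.infAct.comp_right cQ).comp_left d)), ?_⟩
  rw [mul_add, mul_sub, ← mul_assoc cQ d, hd, one_mul]
  abel

/-- Every first-order deformation is cohomologous to an entropic one. -/
theorem YBRack.IsBraiding.exists_entropic {cQ : Module.End A ((Q →₀ A) ⊗[A] (Q →₀ A))}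
    (hcQ : R.IsBraiding cQ) [Fintype R.Inn] (hunit : IsUnit ((Fintype.card R.Inn : A)))
    {f : Module.End A ((Q →₀ A) ⊗[A] (Q →₀ A))} (hf : IsSmall m f)
    (hcoc : matrix f ∈ R.cocycles A) :
    ∃ a ∈ rowFinite Q m, R.IsEntropicMatrix (matrix f + R.coboundary A a) := by
  obtain ⟨a, ha, hZ, hinv⟩ := R.exists_equivariant hunit hcoc
    (fun x y u v => (isSmall_iff_mat2 f).mp hf _ _) (finite_support_matrix f)
  obtain ⟨T, hT, hTa⟩ := exists_mat1_eq (neg_mem ha)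
  obtain ⟨g, hg, h⟩ := hcQ.exists_gauge hf hT
  have hfg := hcQ.matrix_eq_add_coboundary h
  rw [hTa, LinearMap.map_neg, ← sub_eq_add_neg, eq_sub_iff_add_eq] at hfg
  rw [hfg] at hZ hinv
  obtain ⟨b, hb, hent⟩ := R.exists_entropic_of_equivariant hZ
    (fun x y u v => (isSmall_iff_mat2 g).mp hg _ _) (finite_support_matrix g) hinv
  exact ⟨a + b, add_mem ha hb, by rwa [LinearMap.map_add, ← add_assoc, hfg]⟩

open scoped Classical in
/-- Infinitesimal classification: assume `m² = 0`
and that `|Inn(Q)|` is invertible in `A`.  Then every Yang–Baxter deformation `c`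
of `c_Q` with respect to `m` is equivalent to exactly one entropic deformation
`c_Q ∘ f`. -/
theorem existsUnique_entropic_deformation
    {A Q : Type*} [CommRing A] (R : YBRack Q) (m : Ideal A) (hm : m * m = ⊥)
    [Fintype R.Inn] (hunit : IsUnit ((Fintype.card R.Inn : A)))
    (cQ : ((Q →₀ A) ⊗[A] (Q →₀ A)) →ₗ[A] ((Q →₀ A) ⊗[A] (Q →₀ A)))
    (hcQ : ∀ x y : Q,
      cQ (Finsupp.single x (1 : A) ⊗ₜ[A] Finsupp.single y (1 : A))
        = Finsupp.single y (1 : A) ⊗ₜ[A] Finsupp.single (R.act x y) (1 : A))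
    (c : ((Q →₀ A) ⊗[A] (Q →₀ A)) →ₗ[A] ((Q →₀ A) ⊗[A] (Q →₀ A)))
    (hc : IsYBOp c)
    (hdef : ∀ p q : Q × Q, mat2 A c p q - mat2 A cQ p q ∈ m) :
    ∃! f : ((Q →₀ A) ⊗[A] (Q →₀ A)) →ₗ[A] ((Q →₀ A) ⊗[A] (Q →₀ A)),
      Entropic2 R A f ∧ Function.Bijective f ∧
        (∀ p q : Q × Q, mat2 A f p q - (if p = q then 1 else 0) ∈ m) ∧
        YBEquivalent m (cQ ∘ₗ f) c := by
  have hcQ' : R.IsBraiding cQ := hcQ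
  obtain ⟨d, hd⟩ := hcQ'.exists_mul_eq_one
  set f₀ : Module.End A ((Q →₀ A) ⊗[A] (Q →₀ A)) := d * (c - cQ) with hf₀
  have hf₀s : IsSmall m f₀ := by
    refine IsSmall.comp_left ((isSmall_iff_mat2 _).mpr fun p q => ?_) d
    rw [mat2_sub]
    exact hdef p q
  have hcf : c = cQ * (1 + f₀) := by
    rw [hf₀, mul_add, mul_one, ← mul_assoc, hd, one_mul, add_sub_cancel]
  have hequiv (g : Module.End A ((Q →₀ A) ⊗[A] (Q →₀ A))) (hg : IsSmall m g) :
      YBEquivalent m (cQ * (1 + g)) c ↔ ∃ a : Module.End A (Q →₀ A), IsSmall m a ∧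
        cQ * f₀ + cQ * infAct a = infAct a * cQ + cQ * g := by
    rw [yBEquivalent_iff hm, hcf]
    exact exists_congr fun a => and_congr_right fun ha => conj_iff hm hf₀s hg ha
  have hcoc : YBRack.matrix f₀ ∈ R.cocycles A :=
    hcQ'.matrix_mem_cocycles hm hf₀s (hcf ▸ hc.2)
  obtain ⟨a, ha, hent⟩ := hcQ'.exists_entropic hunit hf₀s hcoc
  obtain ⟨T, hT, hTa⟩ := YBRack.exists_mat1_eq (neg_mem ha)
  obtain ⟨g, hgs, hgT⟩ := hcQ'.exists_gauge hf₀s hT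
  have hgent : R.IsEntropicMatrix (YBRack.matrix g) := by
    have h := hcQ'.matrix_eq_add_coboundary hgT
    rw [hTa, LinearMap.map_neg, ← sub_eq_add_neg, eq_sub_iff_add_eq] at h
    rwa [← h]
  refine ⟨1 + g, ⟨(entropic2_one_add_iff g).mpr hgent, (hgs.equivOneAdd hm).bijective,
    (isSmall_sub_one_iff _).mp (by rwa [add_sub_cancel_left]),
    (hequiv g hgs).mpr ⟨T, hT, hgT⟩⟩, ?_⟩
  rintro f ⟨hfent, -, hfm, hfe⟩
  obtain ⟨g', rfl⟩ : ∃ g' : Module.End A ((Q →₀ A) ⊗[A] (Q →₀ A)), f = 1 + g' :=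
    ⟨f - 1, (add_sub_cancel _ _).symm⟩
  have hg's : IsSmall m g' := by
    rw [← isSmall_sub_one_iff, add_sub_cancel_left] at hfm
    exact hfm
  obtain ⟨T', -, hT'⟩ := (hequiv g' hg's).mp hfe
  have h₁ := hcQ'.matrix_eq_add_coboundary hgT
  have h₂ := hcQ'.matrix_eq_add_coboundary hT'
  have hdiff : YBRack.matrix g' - YBRack.matrix g
      = R.coboundary A (mat1 A T - mat1 A T') := by
    rw [LinearMap.map_sub, sub_eq_sub_iff_add_eq_add, ← h₂, add_comm, ← h₁]
  have hzero := YBRack.IsEntropicMatrix.eq_zero_of_coboundary hunit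
    (hdiff ▸ ((entropic2_one_add_iff g').mp hfent).sub hgent)
  rw [← hdiff, sub_eq_zero] at hzero
  rw [mat2_injective fun x y u v =>
    congrFun (congrFun (congrFun (congrFun hzero x) y) u) v]

end Classification

open scoped Classical in
/-- (Theorem 1, infinitesimal classification.) Assume `m² = 0`
and that `|Inn(Q)|` is invertible in `A`.  Then every Yang–Baxter deformation `c`
of `c_Q` with respect to `m` is equivalent to exactly one entropic deformation
`c_Q ∘ f`. -/
theorem infinitesimal_classification
    {A Q : Type*} [CommRing A] (R : YBRack Q) (m : Ideal A) (hm : m * m = ⊥)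
    [Fintype R.Inn] (hunit : IsUnit ((Fintype.card R.Inn : A)))
    (cQ : ((Q →₀ A) ⊗[A] (Q →₀ A)) →ₗ[A] ((Q →₀ A) ⊗[A] (Q →₀ A)))
    (hcQ : ∀ x y : Q,
      cQ (Finsupp.single x (1 : A) ⊗ₜ[A] Finsupp.single y (1 : A))
        = Finsupp.single y (1 : A) ⊗ₜ[A] Finsupp.single (R.act x y) (1 : A))
    (c : ((Q →₀ A) ⊗[A] (Q →₀ A)) →ₗ[A] ((Q →₀ A) ⊗[A] (Q →₀ A)))
    (hc : IsYBOp c)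
    (hdef : ∀ p q : Q × Q, mat2 A c p q - mat2 A cQ p q ∈ m) :
    ∃! f : ((Q →₀ A) ⊗[A] (Q →₀ A)) →ₗ[A] ((Q →₀ A) ⊗[A] (Q →₀ A)),
      Entropic2 R A f ∧ Function.Bijective f ∧
        (∀ p q : Q × Q, mat2 A f p q - (if p = q then 1 else 0) ∈ m) ∧
        YBEquivalent m (cQ ∘ₗ f) c := by
  exact existsUnique_entropic_deformation R m hm hunit cQ hcQ c hc hdef

end
end
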